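/- arXiv:2502.20251 — 3 statements merged into one kernel-verified Lean document; each statement's English description precedes it below -/
import Mathlib

section
/- Define M : D → D on the double D = 𝔤 × 𝔤* by M(x,α) = ((κ♯)⁻¹(α), 0), where κ♯ is the musical isomorphism of the nondegenerate symmetric invariant form κ. Then M satisfies the Hodge-structure equivariance condition: M⁅a,b⁆ = ⁅a, M b⁆ for every a ∈ 𝔤 × {0} and every b ∈ D. Consequently M is a Hodge structure on the Manin pair (D, 𝔤 × {0}) (the Hodge structure of first-order Yang–Mills theory). -/
/-- The coadjoint action of `𝔤` on its dual: `(coad x β) z = -β ⁅x, z⁆`. -/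
noncomputable def coad {𝔤 : Type*} [LieRing 𝔤] [LieAlgebra ℝ 𝔤]
    (x : 𝔤) (β : Module.Dual ℝ 𝔤) : Module.Dual ℝ 𝔤 :=
  -(β ∘ₗ (LieAlgebra.ad ℝ 𝔤 x))

/-- The bracket of the double `D = 𝔤 × 𝔤*`. -/
noncomputable def dbracket {𝔤 : Type*} [LieRing 𝔤] [LieAlgebra ℝ 𝔤]
    (a b : 𝔤 × Module.Dual ℝ 𝔤) : 𝔤 × Module.Dual ℝ 𝔤 :=
  (⁅a.1, b.1⁆, coad a.1 b.2 - coad b.1 a.2)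

/-- The canonical pairing `⟨(x,α),(y,β)⟩ = α(y) + β(x)` on the double `D = 𝔤 × 𝔤*`. -/
def dpair {𝔤 : Type*} [LieRing 𝔤] [LieAlgebra ℝ 𝔤]
    (a b : 𝔤 × Module.Dual ℝ 𝔤) : ℝ :=
  a.2 b.1 + b.2 a.1

/-- The map `M(x, α) = ((κ♯)⁻¹ α, 0)` on the double `D = 𝔤 × 𝔤*`, where
`f = κ♯ : 𝔤 ≃ 𝔤*` is the musical isomorphism of a nondegenerate form `κ`. -/
noncomputable def hodgeM {𝔤 : Type*} [LieRing 𝔤] [LieAlgebra ℝ 𝔤]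
    (f : 𝔤 ≃ₗ[ℝ] Module.Dual ℝ 𝔤) (a : 𝔤 × Module.Dual ℝ 𝔤) : 𝔤 × Module.Dual ℝ 𝔤 :=
  (f.symm a.2, 0)

/-- The map `M(x,α) = ((κ♯)⁻¹ α, 0)` satisfies the Hodge-structure equivariance condition
`M⁅a,b⁆ = ⁅a, M b⁆` for all `a ∈ 𝔤 × {0}` and `b ∈ D`; consequently (together with
`ker M = 𝔤 × {0} = range M` and self-adjointness) it is a Hodge structure on the Manin pair
`(D, 𝔤 × {0})` — the Hodge structure of first-order Yang–Mills theory. -/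
theorem hodge_structure_YM
    {𝔤 : Type*} [LieRing 𝔤] [LieAlgebra ℝ 𝔤] [FiniteDimensional ℝ 𝔤]
    (κ : 𝔤 →ₗ[ℝ] 𝔤 →ₗ[ℝ] ℝ)
    (hsymm : ∀ x y : 𝔤, κ x y = κ y x)
    (hinv : ∀ x y z : 𝔤, κ ⁅x, y⁆ z = κ x ⁅y, z⁆)
    (f : 𝔤 ≃ₗ[ℝ] Module.Dual ℝ 𝔤) (hf : ∀ x : 𝔤, f x = κ x) :
    (∀ a ∈ (⊤ : Submodule ℝ 𝔤).prod (⊥ : Submodule ℝ (Module.Dual ℝ 𝔤)),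
      ∀ b : 𝔤 × Module.Dual ℝ 𝔤,
        hodgeM f (dbracket a b) = dbracket a (hodgeM f b)) ∧
    {a : 𝔤 × Module.Dual ℝ 𝔤 | hodgeM f a = 0} =
      ((⊤ : Submodule ℝ 𝔤).prod (⊥ : Submodule ℝ (Module.Dual ℝ 𝔤)) : Set (𝔤 × Module.Dual ℝ 𝔤)) ∧
    Set.range (hodgeM f) =
      ((⊤ : Submodule ℝ 𝔤).prod (⊥ : Submodule ℝ (Module.Dual ℝ 𝔤)) : Set (𝔤 × Module.Dual ℝ 𝔤)) ∧
    (∀ a b : 𝔤 × Module.Dual ℝ 𝔤, dpair (hodgeM f a) b = dpair a (hodgeM f b)) := by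
  have hcoad (x y : 𝔤) : coad x (f y) = f ⁅x, y⁆ := by
    ext z
    simp only [coad, hf, LinearMap.neg_apply, LinearMap.comp_apply, LieAlgebra.ad_apply]
    rw [← hinv, ← lie_skew, map_neg, LinearMap.neg_apply, neg_neg]
  refine ⟨?_, ?_, ?_, ?_⟩
  · rintro ⟨x, α⟩ ⟨-, hα⟩ ⟨y, β⟩
    obtain rfl : α = 0 := by simpa using hα
    obtain ⟨w, rfl⟩ := f.surjective β
    have hzero (u : 𝔤) : coad u (0 : Module.Dual ℝ 𝔤) = 0 := by simp [coad]
    simp [hodgeM, dbracket, hzero, hcoad]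
  · ext ⟨x, α⟩
    simp [hodgeM]
  · ext ⟨x, α⟩
    constructor
    · rintro ⟨b, hb⟩
      simp_all [hodgeM]
    · intro h
      obtain rfl : α = 0 := by simpa using h
      exact ⟨(0, f x), by simp [hodgeM]⟩
  · rintro ⟨x, α⟩ ⟨y, β⟩
    obtain ⟨u, rfl⟩ := f.surjective α
    obtain ⟨v, rfl⟩ := f.surjective β
    simpa [hodgeM, dpair, ← hf] using hsymm v u
end

section
/- Let V be a finite-dimensional real vector space with a nondegenerate symmetric bilinear form B, let 𝔤 ⊆ V be a Lagrangian subspace (𝔤 equals its own B-orthogonal complement), and let M : V → V be linear with range M = 𝔤 = ker M and B(Mx,y) = B(x,My) for all x, y. Then there is a unique bilinear form κ on the quotient V/𝔤 such that κ(π x, π y) = B(M x, y) for all x, y ∈ V (π : V → V/𝔤 the projection), and this κ is symmetric and nondegenerate. -/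
/-- Passage from the map description `M` to the pairing description `κ` of a Hodge
structure: given a Lagrangian subspace `𝔤` of `(V, B)` and a `B`-self-adjoint `M` with
`range M = 𝔤 = ker M`, there is a unique bilinear form `κ` on `V ⧸ 𝔤` with
`κ (π x) (π y) = B (M x) y`, and it is symmetric and nondegenerate. -/
theorem hodge_map_to_pairing
    {V : Type*} [AddCommGroup V] [Module ℝ V] [FiniteDimensional ℝ V]
    (B : V →ₗ[ℝ] V →ₗ[ℝ] ℝ)
    (hBsymm : ∀ x y : V, B x y = B y x)
    (hBnd : ∀ x : V, (∀ y : V, B x y = 0) → x = 0)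
    (𝔤 : Submodule ℝ V)
    (hLag : ∀ x : V, x ∈ 𝔤 ↔ ∀ y ∈ 𝔤, B x y = 0)
    (M : V →ₗ[ℝ] V)
    (hran : LinearMap.range M = 𝔤)
    (hker : LinearMap.ker M = 𝔤)
    (hself : ∀ x y : V, B (M x) y = B x (M y)) :
    (∃! κ : (V ⧸ 𝔤) →ₗ[ℝ] (V ⧸ 𝔤) →ₗ[ℝ] ℝ,
      ∀ x y : V, κ (Submodule.Quotient.mk x) (Submodule.Quotient.mk y) = B (M x) y) ∧
    (∀ κ : (V ⧸ 𝔤) →ₗ[ℝ] (V ⧸ 𝔤) →ₗ[ℝ] ℝ,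
      (∀ x y : V, κ (Submodule.Quotient.mk x) (Submodule.Quotient.mk y) = B (M x) y) →
      (∀ u v : V ⧸ 𝔤, κ u v = κ v u) ∧
      (∀ u : V ⧸ 𝔤, (∀ v : V ⧸ 𝔤, κ u v = 0) → u = 0)) := by
  have hM : ∀ {x : V}, x ∈ 𝔤 ↔ M x = 0 := by
    intro x
    rw [← hker, LinearMap.mem_ker]
  refine ⟨⟨LinearMap.liftQ₂ 𝔤 𝔤 (B ∘ₗ M) ?_ ?_, fun x y => rfl, ?_⟩, fun κ hκ => ⟨?_, ?_⟩⟩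
  · intro x hx
    simp [LinearMap.mem_ker, hM.1 hx]
  · intro y hy
    rw [LinearMap.mem_ker]
    ext x
    simp [hself, hM.1 hy]
  · intro κ hκ
    ext x y
    exact hκ x y
  · rintro ⟨x⟩ ⟨y⟩
    exact (hκ x y).trans ((hself x y).trans ((hBsymm x (M y)).trans (hκ y x).symm))
  · rintro ⟨x⟩ hx
    refine (Submodule.Quotient.mk_eq_zero 𝔤).2 (hM.2 (hBnd _ fun y => ?_))
    exact (hκ x y).symm.trans (hx (Submodule.Quotient.mk y))
end

section
/- Let V be a finite-dimensional real vector space with a nondegenerate bilinear form B, and let M : V → V be linear with B(Mx,y) = B(x,My) for all x, y and with range M = ker M =: 𝔤. If 𝔢 is any subspace complementary to 𝔤 (V = 𝔤 ⊕ 𝔢), then the bilinear form (x,y) ↦ B(Mx,y) restricted to 𝔢 × 𝔢 is nondegenerate; in particular it induces a linear isomorphism 𝔢 ≅ 𝔢*. -/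
/-- If `B` is a nondegenerate bilinear form on a finite-dimensional real vector space `V`,
`M` is `B`-self-adjoint with `range M = ker M = 𝔤`, and `𝔢` is a complement of `𝔤`,
then `(x, y) ↦ B (M x) y` is nondegenerate on `𝔢`; in particular it induces a linear
isomorphism `𝔢 ≅ 𝔢*`. -/
theorem mass_form_nondegenerate_on_complement
    {V : Type*} [AddCommGroup V] [Module ℝ V] [FiniteDimensional ℝ V]
    (B : V →ₗ[ℝ] V →ₗ[ℝ] ℝ)
    (hBnd₁ : ∀ x : V, (∀ y : V, B x y = 0) → x = 0)
    (hBnd₂ : ∀ y : V, (∀ x : V, B x y = 0) → y = 0)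
    (M : V →ₗ[ℝ] V)
    (hself : ∀ x y : V, B (M x) y = B x (M y))
    (𝔤 : Submodule ℝ V)
    (hran : LinearMap.range M = 𝔤)
    (hker : LinearMap.ker M = 𝔤)
    (𝔢 : Submodule ℝ V)
    (hcompl : IsCompl 𝔤 𝔢) :
    (∀ x : 𝔢, (∀ y : 𝔢, B (M x) y = 0) → x = 0) ∧
    (∀ y : 𝔢, (∀ x : 𝔢, B (M x) y = 0) → y = 0) ∧
    ∃ e : 𝔢 ≃ₗ[ℝ] Module.Dual ℝ 𝔢, ∀ x y : 𝔢, e x y = B (M x) y := by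
  have mass_ker : ∀ g ∈ 𝔤, M g = 0 := fun g hg => by
    rwa [← hker, LinearMap.mem_ker] at hg
  have decompose : ∀ v : V, ∃ g ∈ 𝔤, ∃ y ∈ 𝔢, g + y = v := fun v =>
    Submodule.mem_sup.mp (hcompl.sup_eq_top ▸ Submodule.mem_top)
  have eq_zero : ∀ x : 𝔢, M x = 0 → x = 0 := fun x hx =>
    Subtype.ext (Submodule.disjoint_def.mp hcompl.disjoint x
      (hker ▸ LinearMap.mem_ker.mpr hx) x.2)
  have left : ∀ x : 𝔢, (∀ y : 𝔢, B (M x) y = 0) → x = 0 := by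
    refine fun x hx => eq_zero x (hBnd₁ _ fun v => ?_)
    obtain ⟨g, hg, y, hy, rfl⟩ := decompose v
    rw [map_add, hself x g, mass_ker g hg, map_zero, zero_add]
    exact hx ⟨y, hy⟩
  have right : ∀ y : 𝔢, (∀ x : 𝔢, B (M x) y = 0) → y = 0 := by
    refine fun y hy => eq_zero y (hBnd₂ _ fun v => ?_)
    obtain ⟨g, hg, x, hx, rfl⟩ := decompose v
    rw [← hself, map_add, mass_ker g hg, zero_add]
    exact hy ⟨x, hx⟩
  let C : LinearMap.BilinForm ℝ 𝔢 := (B ∘ₗ M).compl₁₂ 𝔢.subtype 𝔢.subtype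
  have hC : C.Nondegenerate := ⟨left, right⟩
  exact ⟨left, right, C.toDual hC, fun _ _ => rfl⟩
end
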